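/- Let a, b, u, v be unit vectors in ℝ^d such that u and v are both orthogonal to span{a,b}, set θ_{ab} = ∠(a,b) and θ_{uv} = ∠(u,v), and let r ∈ ℝ^d have i.i.d. standard Gaussian entries. Then the random variables sign(⟨r,a⟩)sign(⟨r,b⟩) and sign(⟨r,u⟩)sign(⟨r,v⟩) are independent, and in particular E[ ((1 − sign(⟨r,a⟩)sign(⟨r,b⟩))/2 − θ_{ab}/π) · ((1 − sign(⟨r,u⟩)sign(⟨r,v⟩))/2 − θ_{uv}/π) ] = 0. -/

import Mathlib

open MeasureTheory ProbabilityTheory Real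
open scoped ENNReal

noncomputable section

/-- Entrywise sign: `sgn t = 1` if `t ≥ 0`, `-1` otherwise. -/
def sgn (t : ℝ) : ℝ := if 0 ≤ t then 1 else -1

/-- Euclidean (ℓ²) norm. -/
def l2norm {ι : Type*} [Fintype ι] (x : ι → ℝ) : ℝ := Real.sqrt (∑ i, x i ^ 2)

/-- Entrywise ℓ¹ norm. -/
def l1norm {ι : Type*} [Fintype ι] (x : ι → ℝ) : ℝ := ∑ i, |x i|

/-- Supremum (ℓ∞) norm. -/
def linf {ι : Type*} [Fintype ι] (x : ι → ℝ) : ℝ := ⨆ i, |x i|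

/-- Euclidean inner product. -/
def dotp {ι : Type*} [Fintype ι] (x y : ι → ℝ) : ℝ := ∑ i, x i * y i

/-- Angle between two vectors. -/
def angle' {ι : Type*} [Fintype ι] (x y : ι → ℝ) : ℝ :=
  Real.arccos (dotp x y / (l2norm x * l2norm y))

/-- The standard Gaussian measure on `ℝ^d` (i.i.d. `N(0,1)` coordinates). -/
def gaussPi (d : ℕ) : Measure (Fin d → ℝ) := Measure.pi fun _ => gaussianReal 0 1

/-- The Rademacher measure on `ℝ`: `±1` with probability `1/2` each. -/
def radMeasure : Measure ℝ := (2 : ℝ≥0∞)⁻¹ • (Measure.dirac 1 + Measure.dirac (-1))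

instance : IsProbabilityMeasure radMeasure := by
  constructor
  simp only [radMeasure, Measure.smul_apply, Measure.coe_add, Pi.add_apply,
    Measure.dirac_apply' _ MeasurableSet.univ, Set.indicator_univ, Pi.one_apply, smul_eq_mul]
  rw [one_add_one_eq_two, ENNReal.inv_mul_cancel] <;> simp

instance (d : ℕ) : IsProbabilityMeasure (gaussPi d) := by
  unfold gaussPi; infer_instance

/-- i.i.d. Rademacher signs on `ℝ^d`. -/
def radPi (d : ℕ) : Measure (Fin d → ℝ) := Measure.pi fun _ => radMeasure

instance (d : ℕ) : IsProbabilityMeasure (radPi d) := by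
  unfold radPi; infer_instance

/-- Circular shift by `t` positions: the `j`-th entry of `shift t x` is `x ((j - t) mod d)`. -/
def shift {d : ℕ} (t : ℕ) (x : Fin d → ℝ) : Fin d → ℝ :=
  fun j => x ⟨((j : ℕ) + (d - t % d)) % d, Nat.mod_lt _ j.pos⟩

/-- The `k`-bit circulant binary embedding: `sign` of the first `k` entries of
`circ(r) · D · x`, where `D = diag D`. -/
def cbe {d k : ℕ} (hk : k ≤ d) (r D x : Fin d → ℝ) : Fin k → ℝ :=
  fun i => sgn (∑ j, r (Fin.castLE hk i - j) * (D j * x j))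


@[fun_prop]
lemma measurable_sgn : Measurable sgn :=
  Measurable.ite measurableSet_Ici measurable_const measurable_const

lemma sgn_of_nonneg {t : ℝ} (ht : 0 ≤ t) : sgn t = 1 := if_pos ht

lemma sgn_of_neg {t : ℝ} (ht : t < 0) : sgn t = -1 := if_neg ht.not_ge

lemma abs_sgn (t : ℝ) : |sgn t| = 1 := by
  unfold sgn; split_ifs <;> simp

lemma sgn_mul_of_pos {c : ℝ} (hc : 0 < c) (t : ℝ) : sgn (c * t) = sgn t := by
  unfold sgn; simp only [mul_nonneg_iff_of_pos_left hc]

/-- The linear form `r ↦ ⟨r, a⟩`. -/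
def dotpCLM {ι : Type*} [Fintype ι] (a : ι → ℝ) : (ι → ℝ) →L[ℝ] ℝ :=
  ∑ i, a i • ContinuousLinearMap.proj i

lemma dotpCLM_apply {ι : Type*} [Fintype ι] (a r : ι → ℝ) : dotpCLM a r = dotp r a := by
  simp [dotpCLM, dotp, mul_comm]

@[fun_prop]
lemma measurable_dotp {ι : Type*} [Fintype ι] (a : ι → ℝ) : Measurable fun r => dotp r a := by
  simp_rw [← dotpCLM_apply]; fun_prop

lemma l2norm_eq_one_iff {ι : Type*} [Fintype ι] (a : ι → ℝ) : l2norm a = 1 ↔ dotp a a = 1 := by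
  simp only [l2norm, dotp, Real.sqrt_eq_one, pow_two]

lemma iIndepFun_eval_gaussPi (d : ℕ) :
    iIndepFun (fun i (r : Fin d → ℝ) => r i) (gaussPi d) :=
  iIndepFun_pi (X := fun _ x => x) fun _ => aemeasurable_id

lemma map_eval_gaussPi {d : ℕ} (i : Fin d) :
    (gaussPi d).map (fun r => r i) = gaussianReal 0 1 :=
  (measurePreserving_eval (fun _ : Fin d => gaussianReal 0 1) i).map_eq

instance (d : ℕ) : IsGaussian (gaussPi d) := by
  have h (i : Fin d) : HasGaussianLaw (fun r : Fin d → ℝ => r i) (gaussPi d) :=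
    ⟨by rw [map_eval_gaussPi]; infer_instance⟩
  simpa using ((iIndepFun_eval_gaussPi d).hasGaussianLaw h).isGaussian_map

lemma integral_dotp_gaussPi {d : ℕ} (a : Fin d → ℝ) : ∫ r, dotp r a ∂gaussPi d = 0 := by
  have h (i : Fin d) : Integrable (fun r : Fin d → ℝ => r i * a i) (gaussPi d) :=
    (IsGaussian.integrable_dual (gaussPi d)
      (ContinuousLinearMap.proj (R := ℝ) (φ := fun _ : Fin d => ℝ) i)).mul_const _
  simp only [dotp]
  rw [integral_finsetSum _ fun i _ => h i]
  simp [integral_mul_const, gaussPi, integral_eval]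

lemma covariance_eval_gaussPi {d : ℕ} (i j : Fin d) :
    cov[fun r => r i, fun r => r j; gaussPi d] = if i = j then 1 else 0 := by
  have hL (i : Fin d) : MemLp (fun r : Fin d → ℝ => r i) 2 (gaussPi d) :=
    (IsGaussian.memLp_dual (gaussPi d)
      (ContinuousLinearMap.proj (R := ℝ) (φ := fun _ : Fin d => ℝ) i) 2 (by simp))
  split_ifs with hij
  · subst hij
    rw [covariance_self (hL i).aemeasurable]
    have := (measurePreserving_eval (fun _ : Fin d => gaussianReal 0 1) i).variance_fun_comp
      (f := id) aemeasurable_id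
    simpa [gaussPi] using this
  · exact ((iIndepFun_eval_gaussPi d).indepFun hij).covariance_eq_zero (hL i) (hL j)

lemma covariance_dotp_gaussPi {d : ℕ} (a b : Fin d → ℝ) :
    cov[fun r => dotp r a, fun r => dotp r b; gaussPi d] = dotp a b := by
  have hL (a : Fin d → ℝ) (i : Fin d) :
      MemLp (fun r : Fin d → ℝ => r i * a i) 2 (gaussPi d) :=
    (IsGaussian.memLp_dual (gaussPi d)
      (ContinuousLinearMap.proj (R := ℝ) (φ := fun _ : Fin d => ℝ) i) 2 (by simp)).mul_const _
  simp only [dotp]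
  rw [covariance_fun_sum_fun_sum (hL a) (hL b)]
  simp [covariance_mul_const_left, covariance_mul_const_right, covariance_eval_gaussPi]

lemma hasGaussianLaw_dotp {d : ℕ} {ι κ : Type*} [Fintype ι] [Fintype κ]
    (x : ι → Fin d → ℝ) (y : κ → Fin d → ℝ) :
    HasGaussianLaw (fun r => (fun i => dotp r (x i), fun j => dotp r (y j))) (gaussPi d) := by
  have := (IsGaussian.hasGaussianLaw_id (μ := gaussPi d)).map_fun
    ((ContinuousLinearMap.pi fun i => dotpCLM (x i)).prod
      (ContinuousLinearMap.pi fun j => dotpCLM (y j)))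
  simpa [ContinuousLinearMap.pi_apply, dotpCLM_apply, ContinuousLinearMap.coe_pi'] using this

/-- Families of linear forms in a standard Gaussian vector are independent when their coefficient
vectors are mutually orthogonal. -/
lemma indepFun_dotp {d : ℕ} {ι κ : Type*} [Fintype ι] [Fintype κ]
    (x : ι → Fin d → ℝ) (y : κ → Fin d → ℝ) (h : ∀ i j, dotp (x i) (y j) = 0) :
    IndepFun (fun r i => dotp r (x i)) (fun r j => dotp r (y j)) (gaussPi d) :=
  (hasGaussianLaw_dotp x y).indepFun_of_covariance_eval fun i j => by
    rw [covariance_dotp_gaussPi, h]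

lemma map_dotp_gaussPi {d : ℕ} (a : Fin d → ℝ) {s : ℝ} (h : dotp a a = s ^ 2) :
    (gaussPi d).map (fun r => dotp r a) = (gaussianReal 0 1).map (s * ·) := by
  have hg := ((IsGaussian.hasGaussianLaw_id (μ := gaussPi d)).map_fun
    (dotpCLM a)).map_eq_gaussianReal
  simp only [id_eq, dotpCLM_apply] at hg
  rw [hg, integral_dotp_gaussPi, ← covariance_self (by fun_prop), covariance_dotp_gaussPi, h,
    gaussianReal_map_const_mul]
  congr 1
  · simp
  · ext; simp [sq_nonneg]

/-- A pair of linear forms in a standard Gaussian vector with unit coefficient vectors at angle `θ`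
has the law of `(X, cos θ X + sin θ Y)` for independent standard Gaussians `X`, `Y`. -/
lemma integral_dotp_pair {d : ℕ} {a b : Fin d → ℝ} {θ : ℝ} (ha : dotp a a = 1)
    (hb : dotp b b = 1) (hab : dotp a b = cos θ) (F : ℝ → ℝ → ℝ)
    (hF : Measurable (Function.uncurry F)) :
    ∫ r, F (dotp r a) (dotp r b) ∂gaussPi d =
      ∫ p : ℝ × ℝ, F p.1 (cos θ * p.1 + sin θ * p.2)
        ∂(gaussianReal 0 1).prod (gaussianReal 0 1) := by
  set c : Fin d → ℝ := b - cos θ • a with hc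
  have hrc (r : Fin d → ℝ) : dotp r c = dotp r b - cos θ * dotp r a := by
    simp only [hc, dotp, Finset.mul_sum, ← Finset.sum_sub_distrib, Pi.sub_apply, Pi.smul_apply,
      smul_eq_mul]
    exact Finset.sum_congr rfl fun i _ => by ring
  have hcomm (x y : Fin d → ℝ) : dotp x y = dotp y x := by simp only [dotp, mul_comm]
  have hac : dotp a c = 0 := by rw [hrc, ha, hab]; ring
  have hcc : dotp c c = sin θ ^ 2 := by
    rw [hrc, hcomm c a, hac, hcomm c b, hrc, hb, hcomm b a, hab, sin_sq]; ring
  have hind : IndepFun (fun r => dotp r a) (fun r => dotp r c) (gaussPi d) :=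
    (indepFun_dotp (fun _ : Unit => a) (fun _ : Unit => c) fun _ _ => hac).comp
      (measurable_pi_apply ()) (measurable_pi_apply ())
  have hmap := (indepFun_iff_map_prod_eq_prod_map_map (by fun_prop) (by fun_prop)).1 hind
  rw [map_dotp_gaussPi a (s := 1) (by simp [ha]), map_dotp_gaussPi c hcc,
    Measure.map_prod_map _ _ (by fun_prop) (by fun_prop)] at hmap
  have hG : Measurable fun p : ℝ × ℝ => F p.1 (cos θ * p.1 + p.2) :=
    hF.comp (by fun_prop : Measurable fun p : ℝ × ℝ => (p.1, cos θ * p.1 + p.2))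
  have h1 := integral_map (μ := gaussPi d) (φ := fun r => (dotp r a, dotp r c))
    (by fun_prop) hG.aestronglyMeasurable
  rw [hmap, integral_map (by fun_prop) hG.aestronglyMeasurable] at h1
  simpa [hrc] using h1.symm

/-- A function on the plane that is homogeneous of degree zero has Gaussian mean equal to its
average over the unit circle. -/
lemma integral_gaussianReal_prod_of_homogeneous (F : ℝ × ℝ → ℝ)
    (hF : ∀ r, 0 < r → ∀ p : ℝ × ℝ, F (r * p.1, r * p.2) = F p) :
    ∫ p, F p ∂(gaussianReal 0 1).prod (gaussianReal 0 1) =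
      (2 * π)⁻¹ * ∫ φ in (-π)..π, F (cos φ, sin φ) := by
  have key : ∃ C : ℝ, ∀ F : ℝ × ℝ → ℝ,
      (∀ r, 0 < r → ∀ p : ℝ × ℝ, F (r * p.1, r * p.2) = F p) →
      ∫ p, F p ∂(gaussianReal 0 1).prod (gaussianReal 0 1) =
        C * ∫ φ in (-π)..π, F (cos φ, sin φ) := by
    refine ⟨∫ r in Set.Ioi (0 : ℝ), r * (gaussianPDFReal 0 1 r * gaussianPDFReal 0 1 0),
      fun F hF => ?_⟩
    have hpdf (r φ : ℝ) : gaussianPDFReal 0 1 (r * cos φ) * gaussianPDFReal 0 1 (r * sin φ) =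
        gaussianPDFReal 0 1 r * gaussianPDFReal 0 1 0 := by
      have hexp : exp (-(r * cos φ - 0) ^ 2 / (2 * 1)) * exp (-(r * sin φ - 0) ^ 2 / (2 * 1)) =
          exp (-(r - 0) ^ 2 / (2 * 1)) * exp (-(0 - 0) ^ 2 / (2 * 1)) := by
        rw [← exp_add, ← exp_add]
        congr 1
        linear_combination (-r ^ 2 / 2) * sin_sq_add_cos_sq φ
      simp only [gaussianPDFReal, NNReal.coe_one]
      linear_combination (√(2 * π * 1))⁻¹ ^ 2 * hexp
    rw [gaussianReal_of_var_ne_zero _ one_ne_zero,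
      prod_withDensity (measurable_gaussianPDF _ _) (measurable_gaussianPDF _ _),
      integral_withDensity_eq_integral_toReal_smul
        (by have := measurable_gaussianPDF 0 1; fun_prop)
        (ae_of_all _ fun _ => ENNReal.mul_lt_top gaussianPDF_lt_top gaussianPDF_lt_top),
      ← Measure.volume_eq_prod, ← integral_comp_polarCoord_symm,
      intervalIntegral.integral_of_le (by linarith [pi_pos]), integral_Ioc_eq_integral_Ioo,
      polarCoord_target, ← setIntegral_prod_mul, Measure.volume_eq_prod]
    refine setIntegral_congr_fun (measurableSet_Ioi.prod measurableSet_Ioo) fun p hp => ?_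
    have := hF p.1 hp.1 (cos p.2, sin p.2)
    simp only [polarCoord_symm_apply, ENNReal.toReal_mul, toReal_gaussianPDF, smul_eq_mul] at this ⊢
    rw [hpdf, this]; ring
  obtain ⟨C, hC⟩ := key
  have h1 := hC (fun _ => 1) (by simp)
  simp only [integral_const, probReal_univ, intervalIntegral.integral_const, smul_eq_mul] at h1
  rw [hC F hF]
  congr 1
  field_simp
  linarith

lemma integral_sgn_cos_mul_sgn_cos_sub {θ : ℝ} (h0 : 0 ≤ θ) (hπ : θ ≤ π) :
    ∫ φ in (-π)..π, sgn (cos φ) * sgn (cos (φ - θ)) = 2 * π - 4 * θ := by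
  set f : ℝ → ℝ := fun φ => sgn (cos φ) * sgn (cos (φ - θ)) with hf
  have hper : Function.Periodic f (2 * π) := fun φ => by
    simp only [hf, cos_add_two_pi, add_sub_right_comm φ]
  have hshift := hper.intervalIntegral_add_eq (-π) (-(π / 2))
  rw [show -π + 2 * π = π by ring, show -(π / 2) + 2 * π = 3 * π / 2 by ring] at hshift
  rw [hshift]
  have hfi (x y : ℝ) : IntervalIntegrable f volume x y := by
    refine (intervalIntegrable_const (c := (1 : ℝ))).mono_fun
      (Measurable.aestronglyMeasurable (by fun_prop)) (ae_of_all _ fun φ => ?_)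
    simp [hf, abs_sgn]
  have hconst (x y c : ℝ) (hxy : x ≤ y) (h : ∀ φ ∈ Set.Ioo x y, f φ = c) :
      ∫ φ in x..y, f φ = (y - x) * c := by
    rw [intervalIntegral.integral_of_le hxy, integral_Ioc_eq_integral_Ioo,
      setIntegral_congr_fun measurableSet_Ioo h, setIntegral_const]
    simp [hxy]
  have cpos {x : ℝ} (h1 : -(π / 2) < x) (h2 : x < π / 2) : sgn (cos x) = 1 :=
    sgn_of_nonneg (cos_pos_of_mem_Ioo ⟨h1, h2⟩).le
  have cneg {x : ℝ} (h1 : π / 2 < x) (h2 : x < π + π / 2) : sgn (cos x) = -1 :=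
    sgn_of_neg (cos_neg_of_pi_div_two_lt_of_lt h1 h2)
  have cneg' {x : ℝ} (h1 : -(π + π / 2) < x) (h2 : x < -(π / 2)) : sgn (cos x) = -1 := by
    rw [← cos_neg]; exact cneg (by linarith) (by linarith)
  have i1 : ∫ φ in -(π / 2)..(θ - π / 2), f φ = (θ - π / 2 - -(π / 2)) * (-1) := by
    refine hconst _ _ _ (by linarith) fun φ ⟨h1, h2⟩ => ?_
    simp only [hf]
    rw [cpos h1 (by linarith), cneg' (by linarith) (by linarith), one_mul]
  have i2 : ∫ φ in (θ - π / 2)..(π / 2), f φ = (π / 2 - (θ - π / 2)) * 1 := by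
    refine hconst _ _ _ (by linarith) fun φ ⟨h1, h2⟩ => ?_
    simp only [hf]
    rw [cpos (by linarith) h2, cpos (by linarith) (by linarith), one_mul]
  have i3 : ∫ φ in (π / 2)..(θ + π / 2), f φ = (θ + π / 2 - π / 2) * (-1) := by
    refine hconst _ _ _ (by linarith) fun φ ⟨h1, h2⟩ => ?_
    simp only [hf]
    rw [cneg h1 (by linarith), cpos (by linarith) (by linarith), mul_one]
  have i4 : ∫ φ in (θ + π / 2)..(3 * π / 2), f φ = (3 * π / 2 - (θ + π / 2)) * 1 := by
    refine hconst _ _ _ (by linarith) fun φ ⟨h1, h2⟩ => ?_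
    simp only [hf]
    rw [cneg (by linarith) (by linarith), cneg (by linarith) (by linarith), neg_mul_neg, one_mul]
  rw [← intervalIntegral.integral_add_adjacent_intervals (hfi _ (θ - π / 2)) (hfi _ _),
    ← intervalIntegral.integral_add_adjacent_intervals (hfi (θ - π / 2) (π / 2)) (hfi _ _),
    ← intervalIntegral.integral_add_adjacent_intervals (hfi (π / 2) (θ + π / 2)) (hfi _ _),
    i1, i2, i3, i4]
  ring

/-- Sheppard's formula for the expected product of signs of two Gaussian linear forms. -/
lemma integral_sgn_mul_sgn_gaussPi {d : ℕ} {a b : Fin d → ℝ} (ha : l2norm a = 1)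
    (hb : l2norm b = 1) :
    ∫ r, sgn (dotp r a) * sgn (dotp r b) ∂gaussPi d = 1 - 2 * (angle' a b / π) := by
  have hθ : angle' a b = arccos (dotp a b) := by simp [angle', ha, hb]
  rw [l2norm_eq_one_iff] at ha hb
  have hCS : dotp a b ^ 2 ≤ 1 := by
    have := Finset.sum_mul_sq_le_sq_mul_sq Finset.univ a b
    simp only [dotp, ← pow_two] at ha hb ⊢
    simpa [ha, hb] using this
  obtain ⟨hl, hr⟩ := abs_le.1 ((sq_le_one_iff_abs_le_one _).1 hCS)
  have hcos : dotp a b = cos (angle' a b) := by rw [hθ, cos_arccos hl hr]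
  rw [integral_dotp_pair ha hb hcos (fun x y => sgn x * sgn y)
      (by unfold Function.uncurry; fun_prop),
    integral_gaussianReal_prod_of_homogeneous
      (fun p => sgn p.1 * sgn (cos (angle' a b) * p.1 + sin (angle' a b) * p.2))]
  · have : ∀ φ, cos (angle' a b) * cos φ + sin (angle' a b) * sin φ = cos (φ - angle' a b) :=
      fun φ => by rw [cos_sub]; ring
    simp only [this]
    rw [integral_sgn_cos_mul_sgn_cos_sub (hθ ▸ arccos_nonneg _) (hθ ▸ arccos_le_pi _)]
    field_simp
    ring
  · intro r hr p
    dsimp only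
    rw [sgn_mul_of_pos hr, ← sgn_mul_of_pos hr (cos _ * p.1 + sin _ * p.2)]
    ring_nf

/-- If unit vectors `u, v` are both orthogonal to `span{a,b}` (for unit vectors `a, b`), then for
a standard Gaussian `r` the random variables `sign⟨r,a⟩sign⟨r,b⟩` and `sign⟨r,u⟩sign⟨r,v⟩`
are independent, and the expectation of the product of their centered versions is `0`. -/
theorem stmt10 {d : ℕ} (a b u v : Fin d → ℝ)
    (ha : l2norm a = 1) (hb : l2norm b = 1) (hu : l2norm u = 1) (hv : l2norm v = 1)
    (hua : dotp u a = 0) (hub : dotp u b = 0) (hva : dotp v a = 0) (hvb : dotp v b = 0)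
    (θab θuv : ℝ) (hab : θab = angle' a b) (huv : θuv = angle' u v) :
    IndepFun (fun r : Fin d → ℝ => sgn (dotp r a) * sgn (dotp r b))
             (fun r : Fin d → ℝ => sgn (dotp r u) * sgn (dotp r v)) (gaussPi d)
    ∧ (∫ r, ((1 - sgn (dotp r a) * sgn (dotp r b)) / 2 - θab / π) *
            ((1 - sgn (dotp r u) * sgn (dotp r v)) / 2 - θuv / π) ∂(gaussPi d)) = 0 := by
  have hcomm (x y : Fin d → ℝ) : dotp x y = dotp y x := by simp only [dotp, mul_comm]
  have hind : IndepFun (fun r : Fin d → ℝ => sgn (dotp r a) * sgn (dotp r b))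
      (fun r : Fin d → ℝ => sgn (dotp r u) * sgn (dotp r v)) (gaussPi d) := by
    have hs : Measurable fun x : Fin 2 → ℝ => sgn (x 0) * sgn (x 1) := by fun_prop
    refine (indepFun_dotp ![a, b] ![u, v] fun i j => ?_).comp hs hs
    fin_cases i <;> fin_cases j <;> simp [hcomm a, hcomm b, hua, hub, hva, hvb]
  refine ⟨hind, ?_⟩
  have hcenter (θ : ℝ) : Measurable fun t : ℝ => (1 - t) / 2 - θ / π := by fun_prop
  refine ((hind.comp (hcenter θab) (hcenter θuv)).integral_fun_mul_eq_mul_integral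
    (Measurable.aestronglyMeasurable (by fun_prop))
    (Measurable.aestronglyMeasurable (by fun_prop))).trans ?_
  refine mul_eq_zero_of_left ?_ _
  have hfi : Integrable (fun r => sgn (dotp r a) * sgn (dotp r b)) (gaussPi d) :=
    .of_bound (Measurable.aestronglyMeasurable (by fun_prop)) 1
      (ae_of_all _ fun r => by simp [abs_sgn])
  simp only [Function.comp_apply]
  have hdiff : Integrable (fun r => (1 - sgn (dotp r a) * sgn (dotp r b)) / 2) (gaussPi d) :=
    ((integrable_const _).sub hfi).div_const _
  rw [integral_sub hdiff (integrable_const _), integral_div, integral_sub (integrable_const _) hfi, integral_sgn_mul_sgn_gaussPi ha hb, hab]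
  simp

end
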